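/- arXiv:0902.0801 — 2 statements merged into one kernel-verified Lean document; each statement's English description precedes it below -/
import Mathlib

section
/- Let k be a field of characteristic 0, θ a positive integer, N_i ≥ 2 integers, and q_{ij} ∈ k× for 1 ≤ i < j ≤ θ. Let S be the k-algebra generated by x_1,...,x_θ with relations x_i x_j = q_{ij} x_j x_i for i < j and x_i^{N_i} = 0 for all i. Then the Hilbert series of Ext*_S(k,k) satisfies dim_k Ext^n_S(k,k) = binom(n+θ-1, θ-1) for all n ≥ 0. -/
open CategoryTheory FreeAlgebra

variable (k : Type) [Field k]

/-- Relations of a quantum complete intersection. -/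
inductive qciRel (θ : ℕ) (N : Fin θ → ℕ) (q : Fin θ → Fin θ → kˣ) :
    FreeAlgebra k (Fin θ) → FreeAlgebra k (Fin θ) → Prop
  | comm (i j : Fin θ) (hij : i < j) :
      qciRel θ N q (ι k i * ι k j) ((q i j : k) • (ι k j * ι k i))
  | nil (i : Fin θ) : qciRel θ N q (ι k i ^ N i) 0

/-- The quantum complete intersection algebra `S`. -/
abbrev QCI (θ : ℕ) (N : Fin θ → ℕ) (q : Fin θ → Fin θ → kˣ) : Type :=
  RingQuot (qciRel k θ N q)

/-- The augmentation of `S`, sending each generator to `0`. -/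
noncomputable def qciAug (θ : ℕ) (N : Fin θ → ℕ) (q : Fin θ → Fin θ → kˣ)
    (hN : ∀ i, N i ≠ 0) : QCI k θ N q →ₐ[k] k :=
  RingQuot.liftAlgHom k ⟨FreeAlgebra.lift k (fun _ => (0 : k)), by
    rintro a b (⟨i, j, hij⟩ | ⟨i⟩) <;>
      simp [zero_pow (hN _)]⟩


section QCIaux

open Function

variable {k} {θ : ℕ} {N : Fin θ → ℕ} {q : Fin θ → Fin θ → kˣ}

abbrev QI (θ : ℕ) (N : Fin θ → ℕ) : Type :=
  {p : (Fin θ → ℕ) × (Fin θ → ℕ) // ∀ i, p.2 i < N i}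

variable (k) in
/-- total space of the resolution -/
def QK (θ : ℕ) (N : Fin θ → ℕ) (_q : Fin θ → Fin θ → kˣ) : Type := QI θ N →₀ k

noncomputable instance : AddCommGroup (QK k θ N q) := inferInstanceAs (AddCommGroup (QI θ N →₀ k))
noncomputable instance : Module k (QK k θ N q) := inferInstanceAs (Module k (QI θ N →₀ k))

noncomputable def QB : Module.Basis (QI θ N) k (QK k θ N q) := Finsupp.basisSingleOne

open Classical in
/-- basis elements, zero when out of range -/
noncomputable def QE (q : Fin θ → Fin θ → kˣ) (a m : Fin θ → ℕ) : QK k θ N q :=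
  if h : ∀ i, m i < N i then QB (⟨(a, m), h⟩ : QI θ N) else 0

lemma QE_zero {a m : Fin θ → ℕ} (i : Fin θ) (h : N i ≤ m i) : (QE q a m : QK k θ N q) = 0 := by
  unfold QE
  rw [dif_neg]
  intro h'
  exact absurd (h' i) (by omega)

lemma QB_apply (p : QI θ N) : (QB p : QK k θ N q) = QE q p.1.1 p.1.2 := by
  unfold QE
  rw [dif_pos p.2]

lemma QE_eq {a m : Fin θ → ℕ} (h : ∀ i, m i < N i) :
    (QE q a m : QK k θ N q) = QB (⟨(a, m), h⟩ : QI θ N) := by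
  rw [QB_apply]

/-- extend a function on pairs linearly -/
noncomputable def Qlift {W : Type*} [AddCommGroup W] [Module k W]
    (f : (Fin θ → ℕ) → (Fin θ → ℕ) → W) : QK k θ N q →ₗ[k] W :=
  QB.constr k (fun p => f p.1.1 p.1.2)

lemma Qlift_apply {W : Type*} [AddCommGroup W] [Module k W]
    (f : (Fin θ → ℕ) → (Fin θ → ℕ) → W) {a m : Fin θ → ℕ} (h : ∀ i, m i < N i) :
    Qlift f (QE q a m : QK k θ N q) = f a m := by
  rw [QE_eq h, Qlift, Module.Basis.constr_basis]

lemma Qlift_apply' {W : Type*} [AddCommGroup W] [Module k W]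
    (f : (Fin θ → ℕ) → (Fin θ → ℕ) → W) (a m : Fin θ → ℕ)
    (hf : ∀ i, N i ≤ m i → f a m = 0) :
    Qlift f (QE q a m : QK k θ N q) = f a m := by
  by_cases h : ∀ i, m i < N i
  · exact Qlift_apply f h
  · push Not at h
    obtain ⟨i, hi⟩ := h
    rw [hf i hi, QE_zero i hi, map_zero]

lemma QK_ext {W : Type*} [AddCommGroup W] [Module k W] {f g : QK k θ N q →ₗ[k] W}
    (h : ∀ a m, (∀ i, m i < N i) → f (QE q a m) = g (QE q a m)) : f = g := by
  refine QB.ext fun p => ?_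
  rw [QB_apply]
  exact h _ _ p.2

/-- sign -/
noncomputable def Qs (i : Fin θ) (a : Fin θ → ℕ) : k := ∏ j, if j < i then (-1) ^ (a j) else 1

lemma Qs_update_of_lt {i j : Fin θ} (h : j < i) (a : Fin θ → ℕ) (u : ℕ)
    (hu : u % 2 ≠ a j % 2) : (Qs i (update a j u) : k) = - Qs i a := by
  unfold Qs
  rw [Fintype.prod_eq_mul_prod_compl j, Fintype.prod_eq_mul_prod_compl j (fun l => if l < i then (-1) ^ (a l) else (1:k)),
    ← neg_mul]
  congr 1
  · simp only [h, if_true, update_self]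
    rcases Nat.even_or_odd u with h1 | h1 <;> rcases Nat.even_or_odd (a j) with h2 | h2
    · rw [Nat.even_iff] at *; omega
    · simp [h1.neg_one_pow, h2.neg_one_pow]
    · simp [h1.neg_one_pow, h2.neg_one_pow]
    · rw [Nat.odd_iff] at *; omega
  · refine Finset.prod_congr rfl fun l hl => ?_
    have : l ≠ j := by simpa using hl
    rw [update_of_ne this]

lemma Qs_update_of_le {i j : Fin θ} (h : i ≤ j) (a : Fin θ → ℕ) (u : ℕ) :
    (Qs i (update a j u) : k) = Qs i a := by
  unfold Qs
  refine Finset.prod_congr rfl fun l _ => ?_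
  split_ifs with hl
  · rw [update_of_ne (by omega)]
  · rfl

lemma Qs_sq (i : Fin θ) (a : Fin θ → ℕ) : (Qs i a : k) * Qs i a = 1 := by
  unfold Qs
  rw [← Finset.prod_mul_distrib]
  refine Finset.prod_eq_one fun j _ => ?_
  split_ifs
  · rw [← mul_pow]; simp
  · simp

/-- target of a local operator -/
noncomputable def Qopt (q : Fin θ → Fin θ → kˣ) (i : Fin θ) (a m : Fin θ → ℕ) :
    Option (ℕ × ℕ) → QK k θ N q
  | none => 0
  | some p => QE q (update a i p.1) (update m i p.2)

/-- local operator in direction i -/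
noncomputable def QL (f : ℕ → ℕ → Option (ℕ × ℕ)) (i : Fin θ) : QK k θ N q →ₗ[k] QK k θ N q :=
  Qlift fun a m => (Qs i a : k) • Qopt q i a m (f (a i) (m i))

/-- admissibility for a local operator -/
structure Qadm (M : ℕ) (f : ℕ → ℕ → Option (ℕ × ℕ)) : Prop where
  par : ∀ u v p, f u v = some p → p.1 % 2 ≠ u % 2
  rng : ∀ u v p, f u v = some p → M ≤ v → M ≤ p.2

lemma QL_apply {f : ℕ → ℕ → Option (ℕ × ℕ)} {i : Fin θ} (hf : Qadm (N i) f) (a m : Fin θ → ℕ) :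
    QL f i (QE q a m : QK k θ N q) = (Qs i a : k) • Qopt q i a m (f (a i) (m i)) := by
  unfold QL
  rw [Qlift_apply' (fun a m => (Qs i a : k) • Qopt q i a m (f (a i) (m i)))]
  intro j hj
  cases h : f (a i) (m i) with
  | none => simp [Qopt]
  | some p =>
    simp only [Qopt]
    rw [QE_zero j, smul_zero]
    by_cases hij : j = i
    · subst hij
      rw [update_self]; exact hf.rng _ _ _ h hj
    · rwa [update_of_ne hij]

lemma QL_anti {f g : ℕ → ℕ → Option (ℕ × ℕ)} {i j : Fin θ} (hij : i < j) (hf : Qadm (N i) f)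
    (hg : Qadm (N j) g) (x : QK k θ N q) : QL f i (QL g j x) + QL g j (QL f i x) = 0 := by
  have key : QL f i ∘ₗ QL g j + QL g j ∘ₗ QL f i = (0 : QK k θ N q →ₗ[k] QK k θ N q) := by
    refine QK_ext fun a m hm => ?_
    simp only [LinearMap.add_apply, LinearMap.comp_apply, LinearMap.zero_apply, QL_apply hf,
      QL_apply hg, map_smul]
    cases h1 : f (a i) (m i) with
    | none =>
      cases h2 : g (a j) (m j) with
      | none => simp [Qopt]
      | some p =>
        simp only [Qopt, QL_apply hf, update_of_ne hij.ne, h1]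
        simp
    | some r =>
      cases h2 : g (a j) (m j) with
      | none =>
        simp only [Qopt, QL_apply hg, update_of_ne hij.ne', h2]
        simp
      | some p =>
        simp only [Qopt, QL_apply hf, QL_apply hg, update_of_ne hij.ne, update_of_ne hij.ne', h1, h2]
        rw [Qs_update_of_lt hij _ _ (hf.par _ _ _ h1), Qs_update_of_le hij.le,
          update_comm hij.ne' p.1 r.1 a, update_comm hij.ne' p.2 r.2 m, smul_smul, smul_smul, ← add_smul]
        ring_nf
        simp
  exact LinearMap.congr_fun key x

lemma QL_anti' {f g : ℕ → ℕ → Option (ℕ × ℕ)} {i j : Fin θ} (hij : i ≠ j) (hf : Qadm (N i) f)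
    (hg : Qadm (N j) g) (x : QK k θ N q) : QL f i (QL g j x) + QL g j (QL f i x) = 0 := by
  rcases lt_or_gt_of_ne hij with h | h
  · exact QL_anti h hf hg x
  · rw [add_comm]; exact QL_anti h hg hf x

/-- shift -/
def Qδ (M u : ℕ) : ℕ := if u % 2 = 1 then 1 else M - 1

def dl (M : ℕ) (u v : ℕ) : Option (ℕ × ℕ) := if u = 0 then none else some (u - 1, v + Qδ M u)

def hl (M : ℕ) (u v : ℕ) : Option (ℕ × ℕ) :=
  if u % 2 = 1 then (if v + 1 = M then some (u + 1, 0) else none)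
  else (if 0 < v ∧ v < M then some (u + 1, v - 1) else none)

lemma dl_adm (M : ℕ) : Qadm M (dl M) where
  par u v p h := by
    unfold dl at h; split_ifs at h; cases h; dsimp; omega
  rng u v p h hM := by
    unfold dl at h; split_ifs at h; cases h; dsimp; omega

lemma hl_adm (M : ℕ) : Qadm M (hl M) where
  par u v p h := by
    unfold hl at h; split_ifs at h <;> cases h <;> dsimp <;> omega
  rng u v p h hM := by
    unfold hl at h; split_ifs at h <;> cases h <;> dsimp <;> omega

/-- differential -/
noncomputable def Qd : QK k θ N q →ₗ[k] QK k θ N q := ∑ j, QL (dl (N j)) j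

noncomputable def Qh (i : Fin θ) : QK k θ N q →ₗ[k] QK k θ N q := QL (hl (N i)) i

open Classical in
noncomputable def Qπ (i : Fin θ) : QK k θ N q →ₗ[k] QK k θ N q :=
  Qlift fun a m => if a i = 0 ∧ m i = 0 then QE q a m else 0

lemma dl_sq (hN : ∀ i, 2 ≤ N i) (i : Fin θ) (x : QK k θ N q) :
    QL (dl (N i)) i (QL (dl (N i)) i x) = 0 := by
  have key : QL (dl (N i)) i ∘ₗ QL (dl (N i)) i = (0 : QK k θ N q →ₗ[k] QK k θ N q) := by
    refine QK_ext fun a m hm => ?_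
    have := hN i
    simp only [LinearMap.comp_apply, QL_apply (dl_adm _), map_smul, LinearMap.zero_apply]
    simp only [dl]
    split_ifs with h
    · simp [Qopt]
    · simp only [Qopt, QL_apply (dl_adm _), update_self, dl]
      split_ifs with h'
      · simp [Qopt]
      · simp only [Qopt, update_idem]
        rw [QE_zero i]
        · simp
        · simp only [update_self, Qδ]
          split_ifs <;> omega
  exact LinearMap.congr_fun key x

lemma Qd_sq (hN : ∀ i, 2 ≤ N i) (x : QK k θ N q) : Qd (Qd x) = 0 := by
  unfold Qd
  simp only [LinearMap.sum_apply, map_sum]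
  have : ∀ s : Finset (Fin θ), ∑ i ∈ s, ∑ j ∈ s, QL (dl (N i)) i (QL (dl (N j)) j x) = 0 := by
    intro s
    induction s using Finset.induction_on with
    | empty => simp
    | insert i s hi ih =>
      rw [Finset.sum_insert hi, Finset.sum_insert hi, dl_sq hN, zero_add]
      simp only [Finset.sum_insert hi]
      rw [Finset.sum_add_distrib, ih, add_zero, ← Finset.sum_add_distrib]
      refine Finset.sum_eq_zero fun j hj => ?_
      exact QL_anti' (by rintro rfl; exact hi hj) (dl_adm _) (dl_adm _) x
  exact Finset.sum_comm.trans (this _)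

lemma Qπ_apply (i : Fin θ) (x : QK k θ N q) (p : QI θ N) [Decidable (p.1.1 i = 0 ∧ p.1.2 i = 0)] :
    QB.repr (Qπ i x) p = if p.1.1 i = 0 ∧ p.1.2 i = 0 then QB.repr x p else 0 := by
  classical
  have key : (Finsupp.lapply p) ∘ₗ QB.repr.toLinearMap ∘ₗ Qπ i =
      (if p.1.1 i = 0 ∧ p.1.2 i = 0 then (1:k) else 0) •
        ((Finsupp.lapply p) ∘ₗ (QB (k := k) (q := q)).repr.toLinearMap) := by
    refine QK_ext fun a m hm => ?_
    simp only [LinearMap.comp_apply, LinearMap.smul_apply]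
    unfold Qπ
    rw [Qlift_apply _ hm, QE_eq hm]
    by_cases hp : p = (⟨(a, m), hm⟩ : QI θ N)
    · subst hp
      by_cases h : a i = 0 ∧ m i = 0
      · simp only [h, and_self, if_true]; simp
      · simp only [h, if_false]; simp
    · by_cases h : a i = 0 ∧ m i = 0
      · simp only [h, and_self, if_true]; simp [Finsupp.single_apply, Ne.symm hp]
      · simp only [h, if_false]; simp [Finsupp.single_apply, Ne.symm hp]
  have := LinearMap.congr_fun key x
  simp only [LinearMap.comp_apply, LinearMap.smul_apply] at this
  simpa using this

lemma dh_local (hN : ∀ i, 2 ≤ N i) (i : Fin θ) (x : QK k θ N q) :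
    QL (dl (N i)) i (Qh i x) + Qh i (QL (dl (N i)) i x) = x - Qπ i x := by
  have key : QL (dl (N i)) i ∘ₗ Qh i + Qh i ∘ₗ QL (dl (N i)) i =
      LinearMap.id - (Qπ i : QK k θ N q →ₗ[k] QK k θ N q) := by
    refine QK_ext fun a m hm => ?_
    have h2 := hN i
    have hmi := hm i
    unfold Qh Qπ
    simp only [LinearMap.comp_apply, LinearMap.add_apply, LinearMap.sub_apply, LinearMap.id_apply,
      Qlift_apply _ hm, QL_apply (dl_adm _), QL_apply (hl_adm _), map_smul]
    have fin : ∀ u v, u = a i → v = m i → (QE q (update a i u) (update m i v) : QK k θ N q) = QE q a m := by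
      rintro u v rfl rfl
      simp
    have zer : ∀ u v, N i ≤ v → (QE q (update a i u) (update m i v) : QK k θ N q) = 0 := by
      intro u v h
      exact QE_zero i (by simpa using h)
    by_cases hodd : a i % 2 = 1
    · have hne : a i ≠ 0 := by omega
      by_cases hv : m i + 1 = N i
      · have e1 : hl (N i) (a i) (m i) = some (a i + 1, 0) := by simp [hl, hodd, hv]
        have e2 : dl (N i) (a i) (m i) = some (a i - 1, m i + 1) := by simp [dl, hne, Qδ, hodd]
        have e3 : dl (N i) (a i + 1) 0 = some (a i, N i - 1) := by
          simp [dl, Qδ]; omega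
        simp only [e1, e2, Qopt, QL_apply (dl_adm _), update_self, e3, update_idem, hne, false_and,
          if_false, sub_zero, zer _ (m i + 1) (by omega), map_zero, smul_zero, add_zero,
          Qs_update_of_le le_rfl, smul_smul, Qs_sq, one_smul]
        exact fin _ _ rfl (by omega)
      · have e1 : hl (N i) (a i) (m i) = none := by simp [hl, hodd, hv]
        have e2 : dl (N i) (a i) (m i) = some (a i - 1, m i + 1) := by simp [dl, hne, Qδ, hodd]
        have e3 : hl (N i) (a i - 1) (m i + 1) = some (a i - 1 + 1, m i) := by
          have : ¬ ((a i - 1) % 2 = 1) := by omega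
          have h3 : m i + 1 < N i := by omega
          simp [hl, this, h3]
        simp only [e1, e2, Qopt, QL_apply (hl_adm _), update_self, e3, update_idem, hne, false_and,
          if_false, sub_zero, map_zero, smul_zero, zero_add,
          Qs_update_of_le le_rfl, smul_smul, Qs_sq, one_smul]
        exact fin _ _ (by omega) (by omega)
    · by_cases hv : 0 < m i
      · have hne : m i ≠ 0 := by omega
        have e1 : hl (N i) (a i) (m i) = some (a i + 1, m i - 1) := by simp [hl, hodd, hv, hmi]
        have e3 : dl (N i) (a i + 1) (m i - 1) = some (a i, m i - 1 + 1) := by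
          simp [dl, Qδ]; omega
        simp only [e1, Qopt, QL_apply (dl_adm _), update_self, e3, update_idem, hne, and_false,
          if_false, sub_zero, 
          Qs_update_of_le le_rfl, smul_smul, Qs_sq, one_smul]
        rw [fin _ _ rfl (by omega)]
        by_cases ha : a i = 0
        · simp [dl, ha, Qopt]
        · have e2 : dl (N i) (a i) (m i) = some (a i - 1, m i + (N i - 1)) := by
            simp [dl, ha, Qδ, hodd]
          simp only [e2, Qopt]
          rw [zer _ _ (by omega)]
          simp
      · have hm0 : m i = 0 := by omega
        have e1 : hl (N i) (a i) (m i) = none := by simp [hl, hodd, hv]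
        by_cases ha : a i = 0
        · have e2 : dl (N i) (a i) (m i) = none := by simp [dl, ha]
          simp only [e1, e2, Qopt]
          simp [ha, hm0]
        · have e2 : dl (N i) (a i) (m i) = some (a i - 1, m i + (N i - 1)) := by
            simp [dl, ha, Qδ, hodd]
          have e3 : hl (N i) (a i - 1) (m i + (N i - 1)) = some (a i - 1 + 1, 0) := by
            have h4 : ((a i - 1) % 2 = 1) := by omega
            have h3 : m i + (N i - 1) + 1 = N i := by omega
            simp only [hl, h4, h3, if_true]
          simp only [e1, e2, Qopt, QL_apply (hl_adm _), update_self, e3, update_idem, ha, false_and,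
            if_false, sub_zero, map_zero, smul_zero, zero_add,
            Qs_update_of_le le_rfl, smul_smul, Qs_sq, one_smul]
          exact fin _ _ (by omega) (by omega)
  exact LinearMap.congr_fun key x

lemma Qd_h (hN : ∀ i, 2 ≤ N i) (i : Fin θ) (x : QK k θ N q) :
    Qd (Qh i x) + Qh i (Qd x) = x - Qπ i x := by
  rw [← dh_local hN]
  unfold Qd
  simp only [LinearMap.sum_apply, map_sum]
  rw [← Finset.sum_add_distrib]
  refine Finset.sum_eq_single i (fun j _ hj => ?_) (by simp)
  exact QL_anti' hj (dl_adm _) (hl_adm _) x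

open Classical in
/-- projection to homological degree n -/
noncomputable def Qp (n : ℕ) : QK k θ N q →ₗ[k] QK k θ N q :=
  Qlift fun a m => if ∑ i, a i = n then QE q a m else 0

lemma Qp_apply (n : ℕ) (a m : Fin θ → ℕ) [Decidable (∑ i, a i = n)] :
    Qp n (QE q a m : QK k θ N q) = if ∑ i, a i = n then QE q a m else 0 := by
  unfold Qp
  rw [Qlift_apply']
  · congr
  · intro i hi; rw [QE_zero i hi]; simp

lemma sum_update' (a : Fin θ → ℕ) (i : Fin θ) (u : ℕ) :
    ∑ j, update a i u j + a i = ∑ j, a j + u := by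
  rw [Finset.sum_update_of_mem (Finset.mem_univ i), ← Finset.sum_sdiff (Finset.subset_univ {i})]
  simp; ring

lemma Qp_idem (n : ℕ) (x : QK k θ N q) : Qp n (Qp n x) = Qp n x := by
  have key : Qp n ∘ₗ Qp n = (Qp n : QK k θ N q →ₗ[k] QK k θ N q) := by
    classical
    refine QK_ext fun a m hm => ?_
    simp only [LinearMap.comp_apply, Qp_apply]
    split_ifs with h
    · simp [Qp_apply, h]
    · simp
  exact LinearMap.congr_fun key x

lemma Qp_d (n : ℕ) (x : QK k θ N q) : Qp n (Qd x) = Qd (Qp (n+1) x) := by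
  have key : Qp n ∘ₗ Qd = Qd ∘ₗ (Qp (n + 1) : QK k θ N q →ₗ[k] QK k θ N q) := by
    classical
    refine QK_ext fun a m hm => ?_
    simp only [LinearMap.comp_apply, Qp_apply, Qd, LinearMap.sum_apply, map_sum]
    refine Finset.sum_congr rfl fun i _ => ?_
    rw [apply_ite (fun z => QL (dl (N i)) i z), map_zero]
    rw [QL_apply (dl_adm _), map_smul]
    unfold dl
    by_cases h : a i = 0
    · simp [h, Qopt]
    · simp only [h, if_false, Qopt, Qp_apply]
      have := sum_update' a i (a i - 1)
      split_ifs
      · rfl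
      · omega
      · omega
      · simp
  exact LinearMap.congr_fun key x

lemma Qp_zero_d (x : QK k θ N q) : Qd (Qp 0 x) = 0 := by
  have key : Qd ∘ₗ (Qp 0 : QK k θ N q →ₗ[k] QK k θ N q) = 0 := by
    classical
    refine QK_ext fun a m hm => ?_
    simp only [LinearMap.comp_apply, Qp_apply, Qd, LinearMap.sum_apply, LinearMap.zero_apply]
    refine Finset.sum_eq_zero fun i _ => ?_
    split_ifs with h
    · have : a i = 0 := by simpa using (Finset.sum_eq_zero_iff.1 h) i
      rw [QL_apply (dl_adm _)]
      simp [dl, this, Qopt]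
    · simp
  exact LinearMap.congr_fun key x

lemma Qp_h (n : ℕ) (i : Fin θ) (x : QK k θ N q) : Qp (n+1) (Qh i x) = Qh i (Qp n x) := by
  have key : Qp (n+1) ∘ₗ Qh i = Qh i ∘ₗ (Qp n : QK k θ N q →ₗ[k] QK k θ N q) := by
    classical
    refine QK_ext fun a m hm => ?_
    simp only [LinearMap.comp_apply, Qp_apply, Qh]
    rw [apply_ite (fun z => QL (hl (N i)) i z)]
    rw [QL_apply (hl_adm _), map_smul, map_zero]
    have hh : ∀ p, hl (N i) (a i) (m i) = some p → p.1 = a i + 1 := by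
      intro p hp
      unfold hl at hp
      split_ifs at hp <;> cases hp <;> rfl
    cases h : hl (N i) (a i) (m i) with
    | none => simp [Qopt]
    | some p =>
      simp only [Qopt, Qp_apply]
      have := hh p h
      have := sum_update' a i p.1
      split_ifs
      · rfl
      · omega
      · omega
      · simp
  exact LinearMap.congr_fun key x

lemma Qp_repr (n : ℕ) (x : QK k θ N q) (p : QI θ N) (hp : ∑ i, p.1.1 i ≠ n) :
    QB.repr (Qp n x) p = 0 := by
  classical
  have key : (Finsupp.lapply p) ∘ₗ (QB (k := k) (q := q)).repr.toLinearMap ∘ₗ Qp n = 0 := by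
    refine QK_ext fun a m hm => ?_
    simp only [LinearMap.comp_apply, LinearMap.zero_apply, Qp_apply]
    split_ifs with h
    · rw [QE_eq hm]
      have : (⟨(a, m), hm⟩ : QI θ N) ≠ p := by rintro rfl; exact hp h
      simp [Finsupp.single_apply, this]
    · simp
  exact LinearMap.congr_fun key x

lemma Q_exact (hN : ∀ i, 2 ≤ N i) (n : ℕ) (x : QK k θ N q) (hx : Qp n x = x) (hdx : Qd x = 0)
    (T : Finset (Fin θ)) : ∃ y, Qp (n+1) y = y ∧ ∀ p : QI θ N, QB.repr (x - Qd y) p ≠ 0 →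
      ∀ i ∈ T, p.1.1 i = 0 ∧ p.1.2 i = 0 := by
  classical
  induction T using Finset.induction_on with
  | empty => exact ⟨0, by simp, by simp⟩
  | insert i T hi ih =>
    obtain ⟨y, hy, h⟩ := ih
    refine ⟨y + Qh i (x - Qd y), ?_, ?_⟩
    · rw [map_add, hy, Qp_h, map_sub, hx, Qp_d, hy]
    · have e := Qd_h hN i (x - Qd y)
      rw [map_sub Qd, hdx, Qd_sq hN, sub_zero, map_zero, add_zero] at e
      intro p hp
      have e2 : x - Qd (y + Qh i (x - Qd y)) = Qπ i (x - Qd y) := by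
        rw [map_add, e]; abel
      rw [e2, Qπ_apply] at hp
      split_ifs at hp with h0
      · intro j hj
        rcases Finset.mem_insert.1 hj with rfl | hj
        · exact h0
        · exact h p hp j hj
      · exact absurd rfl hp

lemma Q_exact_succ (hN : ∀ i, 2 ≤ N i) (n : ℕ) (x : QK k θ N q) (hx : Qp (n+1) x = x)
    (hdx : Qd x = 0) : ∃ y, Qp (n+1+1) y = y ∧ Qd y = x := by
  obtain ⟨y, hy, h⟩ := Q_exact hN _ x hx hdx Finset.univ
  refine ⟨y, hy, ?_⟩
  have : x - Qd y = 0 := by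
    apply QB.repr.injective
    ext p
    by_contra hp
    rw [map_zero] at hp
    have h1 := h p hp
    have h2 : Qp (n+1) (x - Qd y) = x - Qd y := by rw [map_sub, hx, Qp_d, hy]
    apply hp
    rw [← h2, Qp_repr]
    · simp
    · simp [h1]
  exact (sub_eq_zero.1 this).symm

/-- augmentation-like functionals -/
noncomputable def Qev (f : (Fin θ → ℕ) → k) : QK k θ N q →ₗ[k] k :=
  open Classical in Qlift fun a m => if m = 0 then f a else 0

lemma Qev_apply (hN : ∀ i, 2 ≤ N i) (f : (Fin θ → ℕ) → k) (a m : Fin θ → ℕ) [Decidable (m = 0)] :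
    Qev f (QE q a m : QK k θ N q) = if m = 0 then f a else 0 := by
  unfold Qev
  rw [Qlift_apply']
  · congr
  · intro i hi
    rw [if_neg]
    rintro rfl
    have := hN i
    simp at hi; omega

lemma Qev_d (hN : ∀ i, 2 ≤ N i) (f : (Fin θ → ℕ) → k) (x : QK k θ N q) : Qev f (Qd x) = 0 := by
  classical
  have key : Qev f ∘ₗ (Qd : QK k θ N q →ₗ[k] QK k θ N q) = 0 := by
    refine QK_ext fun a m hm => ?_
    simp only [LinearMap.comp_apply, Qd, LinearMap.sum_apply, LinearMap.zero_apply, map_sum]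
    refine Finset.sum_eq_zero fun i _ => ?_
    rw [QL_apply (dl_adm _)]
    unfold dl
    split_ifs with h
    · simp [Qopt]
    · simp only [Qopt, map_smul, Qev_apply hN]
      rw [if_neg, smul_zero]
      intro h0
      have := congrFun h0 i
      have h2 := hN i
      simp only [update_self, Qδ, Pi.zero_apply] at this
      split_ifs at this <;> omega
  exact LinearMap.congr_fun key x

lemma Q_exact_zero (hN : ∀ i, 2 ≤ N i) (x : QK k θ N q) (hx : Qp 0 x = x)
    (hev : Qev (fun _ => 1) x = 0) : ∃ y, Qp (0+1) y = y ∧ Qd y = x := by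
  classical
  obtain ⟨y, hy, h⟩ := Q_exact hN _ x hx (by rw [← hx]; exact Qp_zero_d x) Finset.univ
  refine ⟨y, hy, ?_⟩
  have h1 : Qev (fun _ => 1) (x - Qd y) = 0 := by rw [map_sub, hev, Qev_d hN, sub_zero]
  have hm : ∀ i, (0 : Fin θ → ℕ) i < N i := fun i => by have := hN i; simp; omega
  have h2 : x - Qd y = QB.repr (x - Qd y) (⟨(0, 0), hm⟩ : QI θ N) • QE q 0 0 := by
    rw [QE_eq hm]
    apply QB.repr.injective
    ext p
    by_cases hp : (⟨(0, 0), hm⟩ : QI θ N) = p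
    · subst hp; simp
    · rw [map_smul, Module.Basis.repr_self, Finsupp.smul_apply, Finsupp.single_apply, if_neg hp, smul_zero]
      by_contra hne
      have := h p hne
      apply hp
      apply Subtype.ext
      apply Prod.ext
      · funext i; exact (this i (Finset.mem_univ i)).1.symm
      · funext i; exact (this i (Finset.mem_univ i)).2.symm
  rw [h2, map_smul, Qev_apply hN, if_pos rfl, smul_eq_mul, mul_one] at h1
  rw [h1, zero_smul] at h2
  exact (sub_eq_zero.1 h2).symm

end QCIaux

section QCIaux2

open Function

variable {k} {θ : ℕ} {N : Fin θ → ℕ} {q : Fin θ → Fin θ → kˣ}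

def Qg (q : Fin θ → Fin θ → kˣ) (i j : Fin θ) : kˣ := if j < i then (q j i)⁻¹ else 1

def Qw (q : Fin θ → Fin θ → kˣ) (i : Fin θ) (t : Fin θ → ℕ) : kˣ := ∏ j, Qg q i j ^ t j

lemma Qw_add (i : Fin θ) (s t : Fin θ → ℕ) : Qw q i (s + t) = Qw q i s * Qw q i t := by
  simp [Qw, pow_add, Finset.prod_mul_distrib]

lemma Qw_update (i j : Fin θ) (t : Fin θ → ℕ) :
    Qw q i (update t j (t j + 1)) = Qw q i t * Qg q i j := by
  unfold Qw
  rw [Fintype.prod_eq_mul_prod_compl j,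
    Fintype.prod_eq_mul_prod_compl j (fun l => Qg q i l ^ t l), update_self, pow_succ]
  have : ∏ l ∈ {j}ᶜ, Qg q i l ^ (update t j (t j + 1) l) = ∏ l ∈ {j}ᶜ, Qg q i l ^ t l := by
    refine Finset.prod_congr rfl fun l hl => ?_
    have : l ≠ j := by simpa using hl
    rw [update_of_ne this]
  rw [this]
  exact mul_right_comm _ _ _

def QD (N : Fin θ → ℕ) (a : Fin θ → ℕ) : Fin θ → ℕ := fun i => (a i / 2) * N i + a i % 2

noncomputable def QX (i : Fin θ) : QK k θ N q →ₗ[k] QK k θ N q :=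
  Qlift fun a m => (Qw q i (m + QD N a) : k) • QE q a (update m i (m i + 1))

lemma QX_apply (i : Fin θ) (a m : Fin θ → ℕ) : QX i (QE q a m : QK k θ N q) =
    (Qw q i (m + QD N a) : k) • QE q a (update m i (m i + 1)) := by
  unfold QX
  rw [Qlift_apply' (fun a m => (Qw q i (m + QD N a) : k) • (QE q a (update m i (m i + 1)) : QK k θ N q))]
  intro j hj
  rw [QE_zero j, smul_zero]
  by_cases hij : j = i
  · subst hij; simp; omega
  · rwa [update_of_ne hij]

lemma QX_comm {i j : Fin θ} (hij : i < j) :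
    (QX i * QX j : Module.End k (QK k θ N q)) = (q i j : k) • (QX j * QX i) := by
  refine QK_ext fun a m hm => ?_
  simp only [Module.End.mul_apply, LinearMap.smul_apply, QX_apply, map_smul, smul_smul,
    update_of_ne hij.ne, update_of_ne hij.ne', Qw_add, Qw_update]
  rw [update_comm hij.ne]
  congr 1
  simp only [Qg, hij, if_true, not_lt.2 hij.le, if_false]
  push_cast
  have := (q i j).ne_zero
  field_simp

lemma QX_pow (i : Fin θ) (r : ℕ) (a m : Fin θ → ℕ) : ∃ c : k,
    (QX i ^ r : Module.End k (QK k θ N q)) (QE q a m) = c • QE q a (update m i (m i + r)) := by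
  induction r with
  | zero => exact ⟨1, by simp⟩
  | succ r ih =>
    obtain ⟨c, hc⟩ := ih
    refine ⟨c * Qw q i (update m i (m i + r) + QD N a), ?_⟩
    rw [pow_succ', Module.End.mul_apply, hc, map_smul, QX_apply, smul_smul, update_idem, update_self]
    rfl

lemma QX_nil (i : Fin θ) : (QX i ^ N i : Module.End k (QK k θ N q)) = 0 := by
  refine QK_ext fun a m hm => ?_
  obtain ⟨c, hc⟩ := QX_pow (q := q) (N := N) i (N i) a m
  rw [hc, QE_zero i (by simp)]
  simp

noncomputable def Qρ : QCI k θ N q →ₐ[k] Module.End k (QK k θ N q) :=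
  RingQuot.liftAlgHom k ⟨FreeAlgebra.lift k QX, by
    rintro a b (⟨i, j, hij⟩ | ⟨i⟩)
    · simp only [map_mul, map_smul, FreeAlgebra.lift_ι_apply]
      exact QX_comm hij
    · simp only [map_pow, map_zero, FreeAlgebra.lift_ι_apply]
      exact QX_nil i⟩

noncomputable instance : Module (QCI k θ N q) (QK k θ N q) :=
  Module.compHom _ (Qρ (k := k) (θ := θ) (N := N) (q := q)).toRingHom

noncomputable def Qx (i : Fin θ) : QCI k θ N q := RingQuot.mkAlgHom k _ (ι k i)

lemma Qsmul_def (s : QCI k θ N q) (v : QK k θ N q) : s • v = Qρ s v := rfl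

lemma Qx_smul (i : Fin θ) (v : QK k θ N q) : (Qx i : QCI k θ N q) • v = QX i v := by
  rw [Qsmul_def, Qx, Qρ, RingQuot.liftAlgHom_mkAlgHom_apply, FreeAlgebra.lift_ι_apply]

instance : IsScalarTower k (QCI k θ N q) (QK k θ N q) where
  smul_assoc r s v := by
    rw [Qsmul_def, Qsmul_def, map_smul]; rfl

lemma Qx_comm {i j : Fin θ} (hij : j < i) :
    (Qx i * Qx j : QCI k θ N q) = (Qg q i j : k) • (Qx j * Qx i) := by
  have h := RingQuot.mkAlgHom_rel k (qciRel.comm (k := k) (N := N) (q := q) j i hij)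
  simp only [map_mul, map_smul] at h
  change Qx j * Qx i = (q j i : k) • (Qx i * Qx j) at h
  rw [h, smul_smul, Qg, if_pos hij]
  simp

lemma Qx_nil (i : Fin θ) : (Qx i ^ N i : QCI k θ N q) = 0 := by
  have h := RingQuot.mkAlgHom_rel k (qciRel.nil (k := k) (N := N) (q := q) i)
  rw [map_pow, map_zero] at h
  exact h

lemma Qinduct {P : QCI k θ N q → Prop} (hk : ∀ r : k, P (algebraMap k _ r)) (hx : ∀ i, P (Qx i))
    (hadd : ∀ s t, P s → P t → P (s + t)) (hmul : ∀ s t, P s → P t → P (s * t)) (s) : P s := by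
  obtain ⟨r, rfl⟩ := RingQuot.mkAlgHom_surjective k (qciRel k θ N q) s
  induction r using FreeAlgebra.induction with
  | grade0 r => rw [AlgHom.commutes]; exact hk r
  | grade1 i => exact hx i
  | mul a b ha hb => rw [map_mul]; exact hmul _ _ ha hb
  | add a b ha hb => rw [map_add]; exact hadd _ _ ha hb

def Qlin {V W : Type} [AddCommMonoid V] [AddCommMonoid W] [Module k V] [Module k W]
    [Module (QCI k θ N q) V] [Module (QCI k θ N q) W] [IsScalarTower k (QCI k θ N q) V]
    [IsScalarTower k (QCI k θ N q) W] (f : V →ₗ[k] W)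
    (hf : ∀ i v, f ((Qx i : QCI k θ N q) • v) = (Qx i : QCI k θ N q) • f v) :
    V →ₗ[QCI k θ N q] W where
  toFun := f
  map_add' := map_add f
  map_smul' s := by
    induction s using Qinduct with
    | hk r => intro v; simp [algebraMap_smul]
    | hx i => exact hf i
    | hadd s t hs ht => intro v; simp only [RingHom.id_apply] at *; rw [add_smul, map_add, hs, ht, add_smul]
    | hmul s t hs ht => intro v; simp only [RingHom.id_apply] at *; rw [mul_smul, hs, ht, mul_smul]

lemma Qd_X (hN : ∀ i, 2 ≤ N i) (i : Fin θ) (v : QK k θ N q) : Qd (QX i v) = QX i (Qd v) := by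
  have key : Qd ∘ₗ QX i = QX i ∘ₗ (Qd : QK k θ N q →ₗ[k] QK k θ N q) := by
    refine QK_ext fun a m hm => ?_
    simp only [LinearMap.comp_apply, Qd, LinearMap.sum_apply, map_sum]
    refine Finset.sum_congr rfl fun j _ => ?_
    rw [QX_apply, map_smul, QL_apply (dl_adm _), QL_apply (dl_adm _), map_smul]
    have h2 := hN j
    by_cases h : a j = 0
    · simp only [dl, h, if_true, Qopt, map_zero, smul_zero]
    · simp only [dl, h, if_false, Qopt, QX_apply]
      have e1 : update m j (m j + Qδ (N j) (a j)) + QD N (update a j (a j - 1)) = m + QD N a := by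
        funext l
        by_cases hl : l = j
        · subst hl
          simp only [Pi.add_apply, update_self, QD, Qδ]
          rcases Nat.even_or_odd' (a l) with ⟨c, hc | hc⟩
          · obtain ⟨c, rfl⟩ : ∃ c', c = c' + 1 := ⟨c - 1, by omega⟩
            have h1 : a l % 2 = 0 := by omega
            have h3 : (a l - 1) / 2 = c := by omega
            have h4 : (a l - 1) % 2 = 1 := by omega
            have h5 : a l / 2 = c + 1 := by omega
            rw [h1, h3, h4, h5, if_neg (by omega), add_mul]
            omega
          · have h1 : a l % 2 = 1 := by omega
            have h3 : (a l - 1) / 2 = c := by omega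
            have h4 : (a l - 1) % 2 = 0 := by omega
            have h5 : a l / 2 = c := by omega
            rw [h1, h3, h4, h5, if_pos rfl]
            omega
        · simp [hl, QD]
      rw [e1, smul_smul, smul_smul, mul_comm]
      congr 2
      by_cases hij : i = j
      · subst hij
        simp only [update_self, update_idem]
        congr 1; omega
      · rw [update_of_ne hij, update_of_ne (Ne.symm hij), update_comm hij]
  exact LinearMap.congr_fun key v

lemma Qp_X (n : ℕ) (i : Fin θ) (v : QK k θ N q) : Qp n (QX i v) = QX i (Qp n v) := by
  classical
  have key : Qp n ∘ₗ QX i = QX i ∘ₗ (Qp n : QK k θ N q →ₗ[k] QK k θ N q) := by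
    refine QK_ext fun a m hm => ?_
    simp only [LinearMap.comp_apply, QX_apply, map_smul, Qp_apply]
    split_ifs
    · rw [QX_apply]
    · simp
  exact LinearMap.congr_fun key v

lemma Qev_X (hN : ∀ i, 2 ≤ N i) (f) (i : Fin θ) (v : QK k θ N q) : Qev f (QX i v) = 0 := by
  classical
  have key : Qev f ∘ₗ (QX i : QK k θ N q →ₗ[k] QK k θ N q) = 0 := by
    refine QK_ext fun a m hm => ?_
    simp only [LinearMap.comp_apply, QX_apply, map_smul, Qev_apply hN, LinearMap.zero_apply]
    rw [if_neg, smul_zero]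
    intro h
    simpa using congrFun h i
  exact LinearMap.congr_fun key v

lemma QK_ext_S {W : Type} [AddCommGroup W] [Module k W] [Module (QCI k θ N q) W]
    [IsScalarTower k (QCI k θ N q) W]
    {f g : QK k θ N q →ₗ[QCI k θ N q] W} (h : ∀ a, f (QE q a 0) = g (QE q a 0)) : f = g := by
  have key : ∀ r a m, ∑ i, m i = r → f (QE q a m) = g (QE q a m) := by
    intro r
    induction r with
    | zero =>
      intro a m hm
      have : m = 0 := by
        funext i; simpa using (Finset.sum_eq_zero_iff.1 hm) i
      rw [this]; exact h a
    | succ r ih =>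
      intro a m hm
      obtain ⟨i, hi⟩ : ∃ i, m i ≠ 0 := by
        by_contra hc
        push Not at hc
        simp [hc] at hm
      have e1 : update (update m i (m i - 1)) i ((update m i (m i - 1)) i + 1) = m := by
        funext l
        by_cases hl : l = i
        · subst hl; simp; omega
        · simp [hl]
      have e2 := QX_apply (N := N) (q := q) i a (update m i (m i - 1))
      rw [e1, ← Qx_smul] at e2
      have e3 := ih a (update m i (m i - 1)) (by have := sum_update' m i (m i - 1); omega)
      set w := Qw q i (update m i (m i - 1) + QD N a)
      have e4 : QE q a m = (algebraMap k (QCI k θ N q) (↑(w⁻¹) : k) * Qx i) •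
          (QE q a (update m i (m i - 1)) : QK k θ N q) := by
        rw [mul_smul, e2, algebraMap_smul, smul_smul]; simp
      rw [e4, map_smul, map_smul, e3]
  ext v
  have : f.restrictScalars k = g.restrictScalars k := QK_ext fun a m _ => key _ a m rfl
  exact LinearMap.congr_fun this v

lemma ordProd {R : Type} [Ring R] [Algebra k R] : ∀ {θ : ℕ} (x : Fin θ → R) (g : Fin θ → Fin θ → k)
    (_ : ∀ i j, j < i → x i * x j = g i j • (x j * x i)) (_ : ∀ i j, ¬ j < i → g i j = 1)
    (i : Fin θ) (m : Fin θ → ℕ),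
    x i * (List.ofFn fun j => x j ^ m j).prod =
      (∏ j, g i j ^ m j) • (List.ofFn fun j => x j ^ (update m i (m i + 1)) j).prod := by
  intro θ
  induction θ with
  | zero => intro _ _ _ _ i; exact i.elim0
  | succ θ ih =>
    intro x g h1 h2 i m
    rw [List.ofFn_succ, List.ofFn_succ, List.prod_cons, List.prod_cons, Fin.prod_univ_succ]
    refine Fin.cases ?_ (fun i => ?_) i
    · have : ∀ j, g 0 j = 1 := fun j => h2 0 j (by simp)
      simp only [this, one_pow, Finset.prod_const_one, mul_one, one_smul, update_self]
      rw [← mul_assoc, ← pow_succ']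
      congr 1
    · have hc : ∀ r : ℕ, x i.succ * x 0 ^ r = (g i.succ 0 ^ r) • (x 0 ^ r * x i.succ) := by
        intro r
        induction r with
        | zero => simp
        | succ r ihr =>
          rw [pow_succ, ← mul_assoc, ihr, smul_mul_assoc, mul_assoc, h1 _ _ (Fin.succ_pos i),
            mul_smul_comm, smul_smul, ← pow_succ, mul_assoc]
      have := ih (fun j => x j.succ) (fun i j => g i.succ j.succ) (fun i j hij => h1 _ _ (by simpa using hij))
        (fun i j hij => h2 _ _ (by simpa using hij)) i (fun j => m j.succ)
      rw [← mul_assoc, hc, smul_mul_assoc, mul_assoc, this, mul_smul_comm, smul_smul]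
      congr 3
      congr 1
      funext j
      by_cases hj : j = i
      · subst hj; simp
      · rw [update_of_ne hj, update_of_ne (by simpa using hj)]

noncomputable def Qy (m : Fin θ → ℕ) : QCI k θ N q := (List.ofFn fun i => Qx i ^ m i).prod

lemma Qy_mul (i : Fin θ) (m : Fin θ → ℕ) :
    (Qx i * Qy m : QCI k θ N q) = (Qw q i m : k) • Qy (update m i (m i + 1)) := by
  have := ordProd (k := k) (fun i => (Qx i : QCI k θ N q)) (fun i j => (Qg q i j : k))
    (fun i j hij => Qx_comm hij) (fun i j hij => by simp [Qg, hij]) i m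
  unfold Qy
  rw [this]
  simp [Qw]

lemma Qy_zero (m : Fin θ → ℕ) (i : Fin θ) (h : N i ≤ m i) : (Qy m : QCI k θ N q) = 0 := by
  unfold Qy
  refine List.prod_eq_zero ?_
  rw [List.mem_ofFn]
  exact ⟨i, pow_eq_zero_of_le h (Qx_nil i)⟩

def Qc (N : Fin θ → ℕ) (q : Fin θ → Fin θ → kˣ) (a m : Fin θ → ℕ) : kˣ :=
  ∏ i, Qw q i (QD N a) ^ m i

lemma Qc_update (a m : Fin θ → ℕ) (i : Fin θ) :
    Qc N q a (update m i (m i + 1)) = Qc N q a m * Qw q i (QD N a) := by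
  unfold Qc
  rw [Fintype.prod_eq_mul_prod_compl i,
    Fintype.prod_eq_mul_prod_compl i (fun l => Qw q l (QD N a) ^ m l), update_self, pow_succ]
  have : ∏ l ∈ {i}ᶜ, Qw q l (QD N a) ^ (update m i (m i + 1) l) = ∏ l ∈ {i}ᶜ, Qw q l (QD N a) ^ m l := by
    refine Finset.prod_congr rfl fun l hl => ?_
    have : l ≠ i := by simpa using hl
    rw [update_of_ne this]
  rw [this]
  exact mul_right_comm _ _ _

noncomputable def Qψ₀ : QK k θ N q →ₗ[k] ((Fin θ → ℕ) →₀ QCI k θ N q) :=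
  Qlift fun a m => (↑((Qc N q a m)⁻¹) : k) • Finsupp.single a (Qy m)

lemma Qψ₀_apply (a m : Fin θ → ℕ) : Qψ₀ (QE q a m : QK k θ N q) =
    (↑((Qc N q a m)⁻¹) : k) • Finsupp.single a (Qy m) := by
  unfold Qψ₀
  rw [Qlift_apply' (fun a m => (↑((Qc N q a m)⁻¹) : k) • Finsupp.single a (Qy m))]
  intro i hi
  rw [Qy_zero _ i hi]; simp

lemma Qψ₀_X (i : Fin θ) (v : QK k θ N q) :
    Qψ₀ ((Qx i : QCI k θ N q) • v) = (Qx i : QCI k θ N q) • Qψ₀ v := by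
  have key : (Qψ₀ : QK k θ N q →ₗ[k] ((Fin θ → ℕ) →₀ QCI k θ N q)) ∘ₗ QX i =
      (Algebra.lsmul k k ((Fin θ → ℕ) →₀ QCI k θ N q) (Qx i : QCI k θ N q)) ∘ₗ
      (Qψ₀ : QK k θ N q →ₗ[k] ((Fin θ → ℕ) →₀ QCI k θ N q)) := by
    refine QK_ext (k := k) (q := q) (N := N) (W := (Fin θ → ℕ) →₀ QCI k θ N q) fun a m _ => ?_
    simp only [LinearMap.comp_apply, QX_apply, map_smul, Qψ₀_apply, Algebra.lsmul_coe]
    simp only [Finsupp.smul_single, smul_eq_mul, Qy_mul, smul_smul, Qc_update, Qw_add]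
    congr 2
    push_cast
    have := (Qw q i (QD N a)).ne_zero
    have := (Qc N q a m).ne_zero
    field_simp
  rw [Qx_smul]
  exact LinearMap.congr_fun key v

lemma Qproj : Module.Projective (QCI k θ N q) (QK k θ N q) := by
  refine Module.Projective.of_split (Qlin Qψ₀ Qψ₀_X)
    (Finsupp.linearCombination (QCI k θ N q) fun a => (QE q a 0 : QK k θ N q)) ?_
  refine QK_ext_S fun a => ?_
  change Finsupp.linearCombination (QCI k θ N q) _ (Qψ₀ (QE q a 0)) = QE q a 0
  rw [Qψ₀_apply]
  have h1 : Qc N q a 0 = 1 := by simp [Qc]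
  have h2 : (Qy 0 : QCI k θ N q) = 1 := by simp [Qy]
  rw [h1, h2]
  simp

noncomputable def QpS (n : ℕ) : QK k θ N q →ₗ[QCI k θ N q] QK k θ N q :=
  Qlin (Qp n) (fun i v => by rw [Qx_smul, Qx_smul, Qp_X])

noncomputable def QdS (hN : ∀ i, 2 ≤ N i) : QK k θ N q →ₗ[QCI k θ N q] QK k θ N q :=
  Qlin Qd (fun i v => by rw [Qx_smul, Qx_smul, Qd_X hN])

variable (k N q) in
/-- terms of the resolution -/
noncomputable def QKn (n : ℕ) : Submodule (QCI k θ N q) (QK k θ N q) :=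
  LinearMap.eqLocus (QpS n) LinearMap.id

lemma mem_QKn {n : ℕ} {x : QK k θ N q} : x ∈ QKn k N q n ↔ Qp n x = x := Iff.rfl

noncomputable def Qpr (n : ℕ) : QK k θ N q →ₗ[QCI k θ N q] QKn k N q n :=
  (QpS n).codRestrict _ (fun x => Qp_idem n x)

lemma Qpr_val (n : ℕ) (x : QK k θ N q) : ((Qpr n x : QKn k N q n) : QK k θ N q) = Qp n x := rfl

lemma Qpr_coe (n : ℕ) (x : QKn k N q n) : Qpr n (x : QK k θ N q) = x := Subtype.ext x.2

lemma Qproj_n (n : ℕ) : Module.Projective (QCI k θ N q) (QKn k N q n) := by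
  have := Qproj (N := N) (q := q)
  exact Module.Projective.of_split (QKn k N q n).subtype (Qpr n) (by ext x; rw [LinearMap.comp_apply, Submodule.subtype_apply, Qpr_coe]; rfl)

noncomputable def Qdn (hN : ∀ i, 2 ≤ N i) (n : ℕ) :
    QKn k N q (n + 1) →ₗ[QCI k θ N q] QKn k N q n :=
  (QdS hN ∘ₗ (QKn k N q (n + 1)).subtype).codRestrict _ (fun x => by
    rw [mem_QKn]
    change Qp n (Qd (x : QK k θ N q)) = Qd (x : QK k θ N q)
    rw [Qp_d, mem_QKn.1 x.2])

lemma Qdn_coe (hN : ∀ i, 2 ≤ N i) (n : ℕ) (x : QKn k N q (n + 1)) :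
    (Qdn hN n x : QK k θ N q) = Qd (x : QK k θ N q) := rfl

lemma Qpr_zero (n : ℕ) (a : Fin θ → ℕ) (ha : ∑ i, a i ≠ n) :
    Qpr n (QE q a 0) = (0 : QKn k N q n) := by
  classical
  apply Subtype.ext
  rw [Qpr_val, Qp_apply, if_neg ha]; rfl

lemma Qcat_finrank {S : Type} [Ring S] [Algebra k S] {M Z : Type} [AddCommGroup M] [Module S M]
    [AddCommGroup Z] [Module S Z] {I : Type} [Finite I] (φ : (M →ₗ[S] Z) → (I → k))
    (hφ : Function.Bijective φ) (ha : ∀ f g, φ (f + g) = φ f + φ g)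
    (hs : ∀ (r : k) f g, (∀ x, g x = algebraMap k S r • f x) → φ g = r • φ f) :
    Module.finrank k (ModuleCat.of S M ⟶ ModuleCat.of S Z) = Nat.card I := by
  let Φ : (ModuleCat.of S M ⟶ ModuleCat.of S Z) →ₗ[k] (I → k) :=
    { toFun := fun f => φ f.hom
      map_add' := fun f g => ha f.hom g.hom
      map_smul' := fun r f => hs r f.hom (r • f).hom fun x => rfl }
  have hΦ : Function.Bijective Φ := by
    constructor
    · intro f g h
      exact ModuleCat.hom_ext (hφ.1 h)
    · intro c
      obtain ⟨f, hf⟩ := hφ.2 c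
      exact ⟨ModuleCat.ofHom f, hf⟩
  have := Fintype.ofFinite I
  rw [(LinearEquiv.ofBijective Φ hΦ).finrank_eq, Module.finrank_fintype_fun_eq_card,
    Nat.card_eq_fintype_card]

section
variable [Module (QCI k θ N q) k] [IsScalarTower k (QCI k θ N q) k]
  (hx : ∀ i (z : k), (Qx i : QCI k θ N q) • z = 0)
include hx

noncomputable def QevS (hN : ∀ i, 2 ≤ N i) (f : (Fin θ → ℕ) → k) : QK k θ N q →ₗ[QCI k θ N q] k :=
  Qlin (Qev f) (fun i v => by rw [Qx_smul, hx, Qev_X hN])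

lemma QevS_apply (hN : ∀ i, 2 ≤ N i) (f : (Fin θ → ℕ) → k) (v : QK k θ N q) :
    QevS hx hN f v = Qev f v := rfl

lemma Qfun_eq (hN : ∀ i, 2 ≤ N i) (n : ℕ) (f : QKn k N q n →ₗ[QCI k θ N q] k) (x : QKn k N q n) :
    f x = Qev (fun a => f (Qpr n (QE q a 0))) (x : QK k θ N q) := by
  classical
  have : f ∘ₗ Qpr n = QevS hx hN (fun a => f (Qpr n (QE q a 0))) := by
    refine QK_ext_S fun a => ?_
    rw [LinearMap.comp_apply, QevS_apply, Qev_apply hN, if_pos rfl]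
  have := LinearMap.congr_fun this (x : QK k θ N q)
  rw [LinearMap.comp_apply, Qpr_coe, QevS_apply] at this
  exact this

lemma Qfun_ext (hN : ∀ i, 2 ≤ N i) (n : ℕ) (f g : QKn k N q n →ₗ[QCI k θ N q] k)
    (h : ∀ a, ∑ i, a i = n → f (Qpr n (QE q a 0)) = g (Qpr n (QE q a 0))) : f = g := by
  ext x
  rw [Qfun_eq hx hN n f x, Qfun_eq hx hN n g x]
  congr 2
  funext a
  by_cases ha : ∑ i, a i = n
  · exact h a ha
  · rw [Qpr_zero n a ha, map_zero, map_zero]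

open Classical in
noncomputable def Qmk (hN : ∀ i, 2 ≤ N i) (n : ℕ) (c : {a : Fin θ → ℕ // ∑ i, a i = n} → k) :
    QKn k N q n →ₗ[QCI k θ N q] k :=
  QevS hx hN (fun a => if h : ∑ i, a i = n then c ⟨a, h⟩ else 0) ∘ₗ (QKn k N q n).subtype

lemma Qmk_apply (hN : ∀ i, 2 ≤ N i) (n : ℕ) (c : {a : Fin θ → ℕ // ∑ i, a i = n} → k)
    (a : {a : Fin θ → ℕ // ∑ i, a i = n}) : Qmk hx hN n c (Qpr n (QE q a.1 0)) = c a := by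
  classical
  unfold Qmk
  rw [LinearMap.comp_apply, Submodule.subtype_apply, QevS_apply, Qpr_val, Qp_apply, if_pos a.2,
    Qev_apply hN, if_pos rfl, dif_pos a.2]

lemma QHom_bij (hN : ∀ i, 2 ≤ N i) (n : ℕ) : Function.Bijective
    (fun (f : QKn k N q n →ₗ[QCI k θ N q] k) (a : {a : Fin θ → ℕ // ∑ i, a i = n}) =>
      f (Qpr n (QE q a.1 0))) := by
  constructor
  · intro f g h
    exact Qfun_ext hx hN n f g fun a ha => congrFun h ⟨a, ha⟩
  · intro c
    exact ⟨Qmk hx hN n c, funext fun a => Qmk_apply hx hN n c a⟩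

end

lemma Qfinite (n : ℕ) : Finite {a : Fin θ → ℕ // ∑ i, a i = n} :=
  Finite.of_equiv _ (Sym.equivNatSumOfFintype (Fin θ) n)

lemma Qcount (hθ : 0 < θ) (n : ℕ) :
    Nat.card {a : Fin θ → ℕ // ∑ i, a i = n} = Nat.choose (n + θ - 1) (θ - 1) := by
  rw [← Nat.card_congr (Sym.equivNatSumOfFintype (Fin θ) n), Nat.card_eq_fintype_card,
    Sym.card_sym_eq_choose, Fintype.card_fin, ← Nat.choose_symm (by omega)]
  congr 1 <;> omega

end QCIaux2

section QCIcat

open CategoryTheory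

lemma Qhom_zero {A : Type} [Ring A] (K : CochainComplex (ModuleCat A) ℕ) (h : ∀ i j, K.d i j = 0)
    (n : ℕ) : Nonempty (K.homology n ≅ K.X n) :=
  ⟨(ShortComplex.HomologyData.ofZeros (K.sc n) (h _ _) (h _ _)).left.homologyIso⟩

lemma Qext_generic {S : Type} [Ring S] [Algebra k S] (M : ℕ → Type) [∀ n, AddCommGroup (M n)]
    [∀ n, Module S (M n)] [∀ n, Module.Projective S (M n)] (Z : Type) [AddCommGroup Z] [Module S Z]
    (d : ∀ n, M (n + 1) →ₗ[S] M n) (e : M 0 →ₗ[S] Z)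
    (dd : ∀ n x, d n (d (n + 1) x) = 0)
    (ex : ∀ n x, d n x = 0 → ∃ y, d (n + 1) y = x)
    (ed : ∀ x, e (d 0 x) = 0) (ex0 : ∀ x, e x = 0 → ∃ y, d 0 y = x)
    (he : Function.Surjective e)
    (hmin : ∀ n (f : M n →ₗ[S] Z) x, f (d n x) = 0) (n : ℕ) :
    Module.finrank k
        (((Ext k (ModuleCat S) n).obj (Opposite.op (ModuleCat.of S Z))).obj (ModuleCat.of S Z)) =
      Module.finrank k (ModuleCat.of S (M n) ⟶ ModuleCat.of S Z) := by
  let C : ChainComplex (ModuleCat S) ℕ := ChainComplex.of (fun n => ModuleCat.of S (M n))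
    (fun n => ModuleCat.ofHom (d n)) (fun n => by ext x; exact dd n x)
  have hC : ∀ n, C.d (n + 1) n = ModuleCat.ofHom (d n) := fun n =>
    ChainComplex.of_d (fun n => ModuleCat.of S (M n)) (fun n => ModuleCat.ofHom (d n)) n
  have hπ : C.d 1 0 ≫ ModuleCat.ofHom e = 0 := by
    rw [hC]; ext x; exact ed x
  let P : ProjectiveResolution (ModuleCat.of S Z) :=
    { complex := C
      projective := fun n => by
        change Projective (ModuleCat.of S (M n))
        exact ModuleCat.projective_of_categoryTheory_projective _
      π := (ChainComplex.toSingle₀Equiv _ _).symm ⟨ModuleCat.ofHom e, hπ⟩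
      quasiIso := ⟨fun n => by
        cases n with
        | zero =>
          rw [ChainComplex.quasiIsoAt₀_iff, ShortComplex.quasiIso_iff_of_zeros']
          · let T : ShortComplex (ModuleCat S) := ShortComplex.mk (ModuleCat.ofHom (d 0))
              (ModuleCat.ofHom e) (by ext x; exact ed x)
            have hT : T.Exact := by
              rw [ShortComplex.moduleCat_exact_iff]
              exact fun x hx => ex0 x hx
            have hT2 : Epi T.g := by
              rw [ModuleCat.epi_iff_surjective]
              exact he
            refine (ShortComplex.exact_and_epi_g_iff_of_iso ?_).2 ⟨hT, hT2⟩
            refine ShortComplex.isoMk (Iso.refl _) (Iso.refl _) (Iso.refl _) ?_ ?_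
            · change 𝟙 _ ≫ ModuleCat.ofHom (d 0) = C.d 1 0 ≫ 𝟙 _
              rw [hC, Category.id_comp, Category.comp_id]
            · change 𝟙 _ ≫ ModuleCat.ofHom e = _ ≫ 𝟙 _
              have h1 := ChainComplex.toSingle₀Equiv_symm_apply_f_zero (C := C) (X := ModuleCat.of S Z) (ModuleCat.ofHom e) hπ
              refine (Category.id_comp _).trans (Eq.trans ?_ (Category.comp_id _).symm)
              exact h1.symm
          all_goals rfl
        | succ m =>
          rw [quasiIsoAt_iff_exactAt' (hL := ChainComplex.exactAt_succ_single_obj ..),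
            HomologicalComplex.exactAt_iff' _ (m + 2) (m + 1) m (by simp) (by simp)]
          rw [ShortComplex.moduleCat_exact_iff]
          intro x hx
          change (C.d (m + 1) m).hom x = 0 at hx
          change ∃ y, (C.d (m + 2) (m + 1)).hom y = x
          rw [hC] at hx ⊢
          exact ex m x hx⟩ }
  have hz : ∀ i j, (P.complex.linearYonedaObj k (ModuleCat.of S Z)).d i j = 0 := by
    intro i j
    ext f
    change C.d j i ≫ f = 0
    by_cases hij : j = i + 1
    · subst hij
      rw [hC]
      ext x
      exact hmin i f.hom x
    · rw [C.shape _ _ (fun h => hij h.symm)]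
      exact Limits.zero_comp
  obtain ⟨φ⟩ := Qhom_zero (P.complex.linearYonedaObj k (ModuleCat.of S Z)) hz n
  exact (P.isoExt n _ ≪≫ φ).toLinearEquiv.finrank_eq

end QCIcat

section QCIfin

variable {k} in
lemma Qmain {θ : ℕ} (hθ : 0 < θ) {N : Fin θ → ℕ} (hN : ∀ i, 2 ≤ N i)
    {q : Fin θ → Fin θ → kˣ} (n : ℕ) [Module (QCI k θ N q) k] [IsScalarTower k (QCI k θ N q) k]
    (hx : ∀ i (z : k), (Qx i : QCI k θ N q) • z = 0) :
    Module.finrank k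
      (((Ext k (ModuleCat (QCI k θ N q)) n).obj
          (Opposite.op (ModuleCat.of (QCI k θ N q) k))).obj
        (ModuleCat.of (QCI k θ N q) k)) = Nat.choose (n + θ - 1) (θ - 1) := by
  classical
  have hp : ∀ n, Module.Projective (QCI k θ N q) (QKn k N q n) := fun n => Qproj_n n
  have φ := Qext_generic k (S := QCI k θ N q) (fun n => QKn k N q n) k (Qdn hN)
    (QevS hx hN (fun _ => 1) ∘ₗ (QKn k N q 0).subtype)
    (fun n x => Subtype.ext (by rw [Qdn_coe, Qdn_coe, Qd_sq hN]; rfl))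
    (fun n x hdx => by
      obtain ⟨y, hy, hy'⟩ := Q_exact_succ hN n (x : QK k θ N q) (mem_QKn.1 x.2)
        (by rw [← Qdn_coe hN, hdx]; rfl)
      exact ⟨⟨y, mem_QKn.2 hy⟩, Subtype.ext hy'⟩)
    (fun x => by
      rw [LinearMap.comp_apply, Submodule.subtype_apply, QevS_apply, Qdn_coe, Qev_d hN])
    (fun x hev => by
      rw [LinearMap.comp_apply, Submodule.subtype_apply, QevS_apply] at hev
      obtain ⟨y, hy, hy'⟩ := Q_exact_zero hN (x : QK k θ N q) (mem_QKn.1 x.2) hev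
      exact ⟨⟨y, mem_QKn.2 hy⟩, Subtype.ext hy'⟩)
    (fun z => by
      refine ⟨⟨z • QE q 0 0, ?_⟩, ?_⟩
      · rw [mem_QKn, map_smul, Qp_apply, if_pos (by simp)]
      · rw [LinearMap.comp_apply, Submodule.subtype_apply, QevS_apply, map_smul, Qev_apply hN,
          if_pos rfl]
        simp)
    (fun n f x => by rw [Qfun_eq hx hN n f, Qdn_coe, Qev_d hN]) n
  rw [← Qcount hθ n]
  have := Qfinite (θ := θ) n
  refine φ.trans ?_
  exact Qcat_finrank (S := QCI k θ N q) _ (QHom_bij hx hN n) (fun f g => rfl) (fun r f g h => by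
    funext a
    simp only [h, algebraMap_smul, Pi.smul_apply])

end QCIfin

theorem test (θ : ℕ) (hθ : 0 < θ) (N : Fin θ → ℕ) (hN : ∀ i, 2 ≤ N i)
    (q : Fin θ → Fin θ → kˣ) (hchar : CharZero k) (n : ℕ) :
    letI : Module (QCI k θ N q) k :=
      Module.compHom k (qciAug k θ N q (fun i => by have := hN i; omega)).toRingHom
    Module.finrank k
      (((Ext k (ModuleCat (QCI k θ N q)) n).obj
          (Opposite.op (ModuleCat.of (QCI k θ N q) k))).obj
        (ModuleCat.of (QCI k θ N q) k)) = Nat.choose (n + θ - 1) (θ - 1) := by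
  have hN0 : ∀ i, N i ≠ 0 := fun i => by have := hN i; omega
  letI inst : Module (QCI k θ N q) k := Module.compHom k (qciAug k θ N q hN0).toRingHom
  have hsm : ∀ (s : QCI k θ N q) (z : k), s • z = qciAug k θ N q hN0 s * z := fun _ _ => rfl
  haveI : IsScalarTower k (QCI k θ N q) k := ⟨fun r s z => by
    rw [hsm, hsm, map_smul, smul_mul_assoc]⟩
  exact Qmain hθ hN n fun i z => by
    rw [hsm, Qx, qciAug, RingQuot.liftAlgHom_mkAlgHom_apply, FreeAlgebra.lift_ι_apply, zero_mul]
end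

section
/- Let u(D,λ,μ) be a finite dimensional pointed Hopf algebra from the Andruskiewitsch–Schneider classification. Then there is an isomorphism of graded algebras H*(u(D,λ,μ), k) ≅ H*(u(D,λ,0), k); i.e., the cohomology with trivial coefficients does not depend on the root vector parameters μ. -/
open CategoryTheory CategoryTheory.Abelian

variable (k : Type) [Field k]

/-- The root vector relations `x_α^{N_α} = u_α(μ)` defining `u(D,λ,μ)` as a quotient of
`U(D,λ)`. -/
inductive rootRel (U : Type) [Ring U] {P : Type} (x : P → U) (N : P → ℕ) (z : P → U) :
    U → U → Prop
  | rel (α : P) : rootRel U x N z (x α ^ N α) (z α)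

/-- `u(D,λ,μ)`: the quotient of `U = U(D,λ)` by the root vector relations
`x_α^{N_α} - u_α(μ)`. -/
abbrev uDlm (U : Type) [Ring U] [Algebra k U] {P : Type} (x : P → U) (N : P → ℕ)
    (z : P → U) : Type :=
  RingQuot (rootRel U x N z)


section helpers
universe w w₁ w₂ v v₁ v₂ u u₁ u₂ t

/-- isomorphism of Ext algebras, compatible with given families of degree zero classes. -/
def ExtAlgIso {C : Type u} [Category.{v} C] [Abelian C] [HasExt.{w} C]
    {D : Type u₁} [Category.{v₁} D] [Abelian D] [HasExt.{w₁} D] {S : Type t}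
    (X : C) (s : S → (X ⟶ X)) (Y : D) (r : S → (Y ⟶ Y)) : Prop :=
  ∃ e : ∀ n : ℕ, Ext.{w} X X n ≃+ Ext.{w₁} Y Y n,
    (e 0 (Ext.mk₀ (𝟙 X)) = Ext.mk₀ (𝟙 Y)) ∧
    (∀ (a b c : ℕ) (h : a + b = c) (u : Ext X X a) (v : Ext X X b),
      e c (u.comp v h) = (e a u).comp (e b v) h) ∧
    (∀ c, e 0 (Ext.mk₀ (s c)) = Ext.mk₀ (r c))

section
variable {C : Type u} [Category.{v} C] [Abelian C] [HasExt.{w} C]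
    {D : Type u₁} [Category.{v₁} D] [Abelian D] [HasExt.{w₁} D] {S : Type t}
    {E : Type u₂} [Category.{v₂} E] [Abelian E] [HasExt.{w₂} E]

lemma ExtAlgIso.symm {X : C} {s : S → (X ⟶ X)} {Y : D} {r : S → (Y ⟶ Y)}
    (h : ExtAlgIso X s Y r) : ExtAlgIso Y r X s := by
  obtain ⟨e, h1, h2, h3⟩ := h
  refine ⟨fun n => (e n).symm, ?_, ?_, ?_⟩
  · rw [AddEquiv.symm_apply_eq, h1]
  · intro a b c h u v
    rw [AddEquiv.symm_apply_eq, h2]; simp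
  · intro c
    rw [AddEquiv.symm_apply_eq, h3]

lemma ExtAlgIso.trans {X : C} {s : S → (X ⟶ X)} {Y : D} {r : S → (Y ⟶ Y)}
    {Z : E} {q : S → (Z ⟶ Z)}
    (h : ExtAlgIso X s Y r) (h' : ExtAlgIso Y r Z q) : ExtAlgIso X s Z q := by
  obtain ⟨e, h1, h2, h3⟩ := h
  obtain ⟨e', h1', h2', h3'⟩ := h'
  refine ⟨fun n => (e n).trans (e' n), ?_, ?_, ?_⟩
  · simp [h1, h1']
  · intro a b c h u v
    simp [h2, h2']
  · intro c
    simp [h3, h3']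

lemma ExtAlgIso.of_iso {X : C} {s : S → (X ⟶ X)} {Y : C} {r : S → (Y ⟶ Y)} (i : X ≅ Y)
    (hi : ∀ c, s c ≫ i.hom = i.hom ≫ r c) : ExtAlgIso X s Y r := by
  refine ⟨fun n =>
    { toFun := fun u => (Ext.mk₀ i.inv).comp (u.comp (Ext.mk₀ i.hom) (add_zero n)) (zero_add n)
      invFun := fun u => (Ext.mk₀ i.hom).comp (u.comp (Ext.mk₀ i.inv) (add_zero n)) (zero_add n)
      left_inv := fun u => by
        simp [Ext.comp_assoc_of_third_deg_zero]
      right_inv := fun u => by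
        simp [Ext.comp_assoc_of_third_deg_zero]
      map_add' := fun u v => by simp }, ?_, ?_, ?_⟩
  · simp
  · intro a b c h u v
    subst h
    simp only [AddEquiv.coe_mk, Equiv.coe_fn_mk]
    rw [Ext.comp_assoc (a₁ := 0) (a₂ := a) (a₃ := b) (a₁₂ := a) (a₂₃ := a + b) _ _ _
      (zero_add a) rfl (by omega)]
    congr 1
    rw [Ext.comp_assoc (a₁ := a) (a₂ := 0) (a₃ := b) (a₁₂ := a) (a₂₃ := b) _ _ _
      (add_zero a) (zero_add b) (by omega)]
    rw [Ext.mk₀_comp_mk₀_assoc]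
    simp
  · intro c
    simp [hi]

lemma ExtAlgIso.of_functor (F : C ⥤ D) [F.Additive] [Limits.PreservesFiniteLimits F]
    [Limits.PreservesFiniteColimits F] [F.Full] [F.Faithful] [EnoughProjectives C]
    [F.PreservesProjectiveObjects] (X : C) (s : S → (X ⟶ X)) :
    ExtAlgIso X s (F.obj X) (fun c => F.map (s c)) := by
  refine ⟨fun n => AddEquiv.ofBijective (F.mapExtAddHom X X n)
    (F.mapExt_bijective_of_preservesProjectiveObjects X X n), ?_, ?_, ?_⟩
  · simp [Ext.mapExactFunctor_mk₀]
  · intro a b c h u v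
    simp [Ext.mapExactFunctor_comp]
  · intro c
    simp [Ext.mapExactFunctor_mk₀]
end

section rings

lemma restrict_full {A B : Type} [Ring A] [Ring B] (f : A →+* B) (j : B → A)
    (hfj : ∀ b, f (j b) = b) : (ModuleCat.restrictScalars.{0} f).Full where
  map_surjective {X Y} g := by
    refine ⟨ModuleCat.ofHom
      { toFun := fun x => g.hom x
        map_add' := fun x y => g.hom.map_add x y
        map_smul' := fun b x => ?_ }, ?_⟩
    · have h : g.hom (f (j b) • (x : X)) = f (j b) • (g.hom x : Y) := g.hom.map_smul (j b) x
      rw [hfj] at h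
      exact h
    · ext x; rfl

lemma module_proj {A B : Type} [Ring A] [Ring B] (f : A →+* B) (j : B → A)
    (hj : ∀ x y, j (x + y) = j x + j y)
    (hja : ∀ a b, j (f a * b) = a * j b) (hfj : ∀ b, f (j b) = b)
    (P : Type) [AddCommGroup P] [Module B P] [Module A P] (hP : ∀ (a : A) (p : P), a • p = f a • p)
    (h : Module.Projective B P) : Module.Projective A P := by
  have j0 : j 0 = 0 := by simpa using hj 0 0
  obtain ⟨s, hs⟩ := Module.projective_def.1 h
  rw [Module.projective_def]
  refine ⟨{ toFun := fun q => Finsupp.mapRange j j0 (s q)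
            map_add' := fun p q => ?_
            map_smul' := fun a q => ?_ }, fun q => ?_⟩
  · ext x
    simp [hj]
  · ext x
    simp [hP, hja]
  · refine Eq.trans ?_ (hs q)
    simp only [LinearMap.coe_mk, AddHom.coe_mk]
    rw [Finsupp.linearCombination_apply, Finsupp.linearCombination_apply,
      Finsupp.sum_mapRange_index]
    · refine Finsupp.sum_congr fun x _ => ?_
      rw [hP, hfj]
    · intro x; exact zero_smul _ _

lemma restrict_proj {A B : Type} [Ring A] [Ring B] (f : A →+* B) (j : B → A)
    (hj : ∀ x y, j (x + y) = j x + j y)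
    (hja : ∀ a b, j (f a * b) = a * j b) (hfj : ∀ b, f (j b) = b) :
    (ModuleCat.restrictScalars.{0} f).PreservesProjectiveObjects where
  projective_obj {P} hP := by
    have hP' : Module.Projective B P := (IsProjective.iff_projective (R := B) P).2 hP
    suffices h : Module.Projective A ((ModuleCat.restrictScalars.{0} f).obj P) from
      (IsProjective.iff_projective (R := A) ((ModuleCat.restrictScalars.{0} f).obj P)).1 h
    let _ : Module A P := Module.compHom P f
    exact module_proj f j hj hja hfj P (fun _ _ => rfl) hP'

lemma ExtAlgIso.of_ringHom {A B : Type} [Ring A] [Ring B] [HasExt.{1} (ModuleCat.{0} A)]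
    [HasExt.{1} (ModuleCat.{0} B)] {S : Type} (f : A →+* B) (j : B → A)
    (hj : ∀ x y, j (x + y) = j x + j y)
    (hja : ∀ a b, j (f a * b) = a * j b) (hfj : ∀ b, f (j b) = b)
    (X : ModuleCat.{0} B) (s : S → (X ⟶ X)) (Y : ModuleCat.{0} A) (r : S → (Y ⟶ Y))
    (i : (ModuleCat.restrictScalars f).obj X ≅ Y)
    (hi : ∀ c, (ModuleCat.restrictScalars f).map (s c) ≫ i.hom = i.hom ≫ r c) :
    ExtAlgIso.{1, 1} X s Y r := by
  have := restrict_full f j hfj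
  have := restrict_proj f j hj hja hfj
  have : Limits.PreservesFiniteLimits (ModuleCat.restrictScalars.{0} f) :=
    ⟨fun J _ _ => ⟨inferInstance⟩⟩
  have : Limits.PreservesFiniteColimits (ModuleCat.restrictScalars.{0} f) :=
    ⟨fun J _ _ => ⟨inferInstance⟩⟩
  exact (ExtAlgIso.of_functor (ModuleCat.restrictScalars.{0} f) X s).trans
    (ExtAlgIso.of_iso i hi)

lemma ExtAlgIso.of_aug {k A B : Type} [Field k] [Ring A] [Ring B] [Algebra k A] [Algebra k B]
    [HasExt.{1} (ModuleCat.{0} A)]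
    [HasExt.{1} (ModuleCat.{0} B)] (f : A →+* B) (j : B → A)
    (hj : ∀ x y, j (x + y) = j x + j y)
    (hja : ∀ a b, j (f a * b) = a * j b) (hfj : ∀ b, f (j b) = b)
    (εA : A →ₐ[k] k) (εB : B →ₐ[k] k) (hε : ∀ a, εA a = εB (f a)) :
    letI : Module A k := Module.compHom k εA.toRingHom
    letI : Module B k := Module.compHom k εB.toRingHom
    ExtAlgIso.{1, 1} (S := k) (ModuleCat.of B k) (fun c => c • 𝟙 _)
      (ModuleCat.of A k) (fun c => c • 𝟙 _) := by
  let i1 : Module A k := Module.compHom k εA.toRingHom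
  let i2 : Module B k := Module.compHom k εB.toRingHom
  let L : (ModuleCat.restrictScalars f).obj (ModuleCat.of B k) ≃ₗ[A] k :=
      { toFun := fun y => y
        invFun := fun y => y
        left_inv := fun _ => rfl
        right_inv := fun _ => rfl
        map_add' := fun _ _ => rfl
        map_smul' := fun a y => by
          have h := congrArg (fun t : k => t * (show k from y)) (hε a).symm
          exact h }
  refine ExtAlgIso.of_ringHom f j hj hja hfj _ _ _ _ L.toModuleIso ?_
  intro c
  ext y
  exact congrArg (fun t : k => t * (show k from y)) ((εB.commutes c).trans (εA.commutes c).symm)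

end rings
end helpers

/-- common quotient -/
inductive relB (U : Type) [Ring U] {P : Type} (x : P → U) (N : P → ℕ) (e : U) :
    U → U → Prop
  | root (α : P) : relB U x N e (x α ^ N α) 0
  | idem : relB U x N e e 1

lemma half (U : Type) [Ring U] [Algebra k U] (P : Type)
    (x : P → U) (N : P → ℕ) (z : P → U) (e : U) (he : e * e = e) (hc : ∀ u, e * u = u * e)
    (hz : ∀ α, z α * e = 0)
    (ε' : uDlm k U x N z →ₐ[k] k) (εB : RingQuot (relB U x N e) →ₐ[k] k)
    (hεε : ∀ u, ε' (RingQuot.mkAlgHom k _ u) = εB (RingQuot.mkAlgHom k _ u))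
    [HasExt.{1} (ModuleCat.{0} (uDlm k U x N z))]
    [HasExt.{1} (ModuleCat.{0} (RingQuot (relB U x N e)))] :
    letI : Module (uDlm k U x N z) k := Module.compHom k ε'.toRingHom
    letI : Module (RingQuot (relB U x N e)) k := Module.compHom k εB.toRingHom
    ExtAlgIso.{1, 1} (S := k) (ModuleCat.of (RingQuot (relB U x N e)) k) (fun c => c • 𝟙 _)
      (ModuleCat.of (uDlm k U x N z) k) (fun c => c • 𝟙 _) := by
  let i1 : Module (uDlm k U x N z) k := Module.compHom k ε'.toRingHom
  let i2 : Module (RingQuot (relB U x N e)) k := Module.compHom k εB.toRingHom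
  let q : U →+* uDlm k U x N z := RingQuot.mkRingHom _
  let p : U →+* RingQuot (relB U x N e) := RingQuot.mkRingHom _
  have hpe : p e = 1 := by
    have := RingQuot.mkRingHom_rel (relB.idem (x := x) (N := N) (e := e))
    rw [map_one] at this; exact this
  have hqz : ∀ α, q (x α ^ N α) = q (z α) := fun α => RingQuot.mkRingHom_rel (rootRel.rel α)
  have hpx : ∀ α, p (x α ^ N α) = 0 := fun α => by
    have := RingQuot.mkRingHom_rel (relB.root (x := x) (N := N) (e := e) α)
    rw [map_zero] at this; exact this
  have hpz : ∀ α, p (z α) = 0 := fun α => by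
    have := congrArg p (hz α)
    rwa [map_mul, hpe, mul_one, map_zero] at this
  have hqs : Function.Surjective q := RingQuot.mkRingHom_surjective _
  have hps : Function.Surjective p := RingQuot.mkRingHom_surjective _
  have hidem : IsIdempotentElem (q e) := by
    change q e * q e = q e
    rw [← map_mul, he]
  let f : uDlm k U x N z →+* RingQuot (relB U x N e) := RingQuot.lift ⟨p, by
    rintro _ _ ⟨α⟩
    rw [hpx, hpz]⟩
  have hf : ∀ u, f (q u) = p u := fun u => RingQuot.lift_mkRingHom_apply ..
  have hqc : ∀ u, q e * q u = q u * q e := fun u => by rw [← map_mul, hc, map_mul]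
  have hqee : ∀ y, q e * (q e * y) = q e * y := fun y => by rw [← mul_assoc, hidem.eq]
  have hqq : ∀ u, q e * q u * q e = q u * q e := fun u => by
    rw [hqc, mul_assoc, hidem.eq]
  let g0 : U →+* hidem.Corner :=
    { toFun := fun u => ⟨q e * q u * q e, ⟨q u, rfl⟩⟩
      map_one' := Subtype.ext (by
        change q e * q 1 * q e = q e
        rw [map_one, mul_one, hidem.eq])
      map_mul' := fun u v => Subtype.ext (by
        change q e * q (u * v) * q e = (q e * q u * q e) * (q e * q v * q e)
        rw [hqq, hqq, hqq, map_mul, mul_assoc, mul_assoc, ← mul_assoc (q e), hqc v,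
          mul_assoc (q v), hidem.eq])
      map_zero' := Subtype.ext (by
        change q e * q 0 * q e = 0
        simp)
      map_add' := fun u v => Subtype.ext (by
        change q e * q (u + v) * q e = q e * q u * q e + q e * q v * q e
        rw [map_add, mul_add, add_mul]) }
  let g : RingQuot (relB U x N e) →+* hidem.Corner := RingQuot.lift ⟨g0, by
    rintro _ _ (⟨α⟩ | _)
    · refine Subtype.ext ?_
      change q e * q (x α ^ N α) * q e = q e * q 0 * q e
      rw [hqq, hqz, ← map_mul, hz]; simp
    · refine Subtype.ext ?_
      change q e * q e * q e = q e * q 1 * q e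
      rw [map_one, mul_one, hidem.eq, hidem.eq]⟩
  have hg : ∀ u, (g (p u)).1 = q u * q e := fun u => by
    have : g (p u) = g0 u := RingQuot.lift_mkRingHom_apply ..
    rw [this]; exact hqq u
  have hε2 : ∀ a, ε' a = εB (f a) := fun a => by
    obtain ⟨u, rfl⟩ := hqs a
    rw [hf]
    have := hεε u
    rw [← AlgHom.coe_toRingHom (RingQuot.mkAlgHom k _), ← AlgHom.coe_toRingHom (RingQuot.mkAlgHom k _),
      RingQuot.mkAlgHom_coe, RingQuot.mkAlgHom_coe] at this
    exact this
  refine ExtAlgIso.of_aug f (fun b => (g b).1) ?_ ?_ ?_ ε' εB ?_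
  · intro a b
    rw [map_add]; rfl
  · intro a b
    obtain ⟨u, rfl⟩ := hqs a
    obtain ⟨v, rfl⟩ := hps b
    rw [hf, ← map_mul, hg, hg, map_mul, mul_assoc]
  · intro b
    obtain ⟨v, rfl⟩ := hps b
    rw [hg, map_mul, hf, hf, hpe, mul_one]
  · exact hε2

/-- **The cohomology of `u(D,λ,μ)` does not depend on the root vector parameters `μ`.**

Here `U` plays the role of `U(D,λ)`, `x α` of the root vectors, `N α` of the orders
`N_α`, `ε` of the augmentation (the counit), and `z α` of the elements `u_α(μ) ∈ kΓ`;
as in the Andruskiewitsch–Schneider situation the `z α` are central, and lie in the span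
of the elements `γ - 1` for `γ` ranging over a finite central subgroup `G` of grouplike
units with `ε(γ) = 1` (the group elements occurring in the `u_α(μ)`).  The conclusion is
a family of `k`-linear isomorphisms `Hⁿ(u(D,λ,μ),k) ≃ Hⁿ(u(D,λ,0),k)` compatible with
the Yoneda (cup) products and units, i.e. an isomorphism of graded algebras. -/
theorem cohomology_independent_of_root_vector_parameters
    [CharZero k] [IsAlgClosed k]
    (U : Type) [Ring U] [Algebra k U] (P : Type) [Fintype P]
    (x : P → U) (N : P → ℕ) (hN : ∀ α, 2 ≤ N α)
    (ε : U →ₐ[k] k) (hεx : ∀ α, ε (x α) = 0)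
    (z : P → U)
    (G : Subgroup Uˣ) (hGfin : Finite G)
    (hGcentral : ∀ γ : G, ((γ : Uˣ) : U) ∈ Set.center U)
    (hGaug : ∀ γ : G, ε ((γ : Uˣ) : U) = 1)
    (hzcentral : ∀ α, z α ∈ Set.center U)
    (hzspan : ∀ α, z α ∈ Submodule.span k (Set.range fun γ : G => ((γ : Uˣ) : U) - 1)) :
    -- the augmentations of the two quotients
    letI εμ : uDlm k U x N z →ₐ[k] k :=
      RingQuot.liftAlgHom k ⟨ε, by
        rintro a b ⟨α⟩
        have hz : ε (z α) = 0 := by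
          refine Submodule.span_induction ?_ ?_ ?_ ?_ (hzspan α)
          · rintro w ⟨γ, rfl⟩; simp [hGaug γ]
          · simp
          · intro a b _ _ ha hb; simp [ha, hb]
          · intro c a _ ha; simp [ha]
        simp [map_pow, hεx α, zero_pow (by have := hN α; omega : N α ≠ 0), hz]⟩
    letI ε₀ : uDlm k U x N (fun _ => 0) →ₐ[k] k :=
      RingQuot.liftAlgHom k ⟨ε, by
        rintro a b ⟨α⟩
        simp [map_pow, hεx α, zero_pow (by have := hN α; omega : N α ≠ 0)]⟩
    letI : Module (uDlm k U x N z) k := Module.compHom k εμ.toRingHom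
    letI : Module (uDlm k U x N (fun _ => 0)) k := Module.compHom k ε₀.toRingHom
    letI Mμ : ModuleCat (uDlm k U x N z) := ModuleCat.of _ k
    letI M₀ : ModuleCat (uDlm k U x N (fun _ => 0)) := ModuleCat.of _ k
    letI : HasDerivedCategory (ModuleCat (uDlm k U x N z)) := HasDerivedCategory.standard _
    letI : HasDerivedCategory (ModuleCat (uDlm k U x N (fun _ => 0))) :=
      HasDerivedCategory.standard _
    haveI : HasExt.{1} (ModuleCat (uDlm k U x N z)) := hasExt_of_hasDerivedCategory _
    haveI : HasExt.{1} (ModuleCat (uDlm k U x N (fun _ => 0))) :=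
      hasExt_of_hasDerivedCategory _
    ∃ e : ∀ n : ℕ, Ext Mμ Mμ n ≃+ Ext M₀ M₀ n,
      -- the isomorphism preserves the unit and the Yoneda products,
      -- i.e. it is an isomorphism of graded algebras
      (e 0 (Ext.mk₀ (𝟙 Mμ)) = Ext.mk₀ (𝟙 M₀)) ∧
      (∀ (a b : ℕ) (u : Ext Mμ Mμ a) (v : Ext Mμ Mμ b),
        e (a + b) (u.comp v rfl) = (e a u).comp (e b v) rfl) ∧
      -- and it is `k`-linear (scalars acting through degree-zero classes)
      (∀ (n : ℕ) (c : k) (u : Ext Mμ Mμ n),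
        e n ((Ext.mk₀ (c • 𝟙 Mμ)).comp u (zero_add n)) =
          (Ext.mk₀ (c • 𝟙 M₀)).comp (e n u) (zero_add n)) := by
    classical
  have : Fintype G := Fintype.ofFinite G
  let n : k := (Fintype.card G : k)
  have hn : n ≠ 0 := Nat.cast_ne_zero.2 Fintype.card_ne_zero
  let s : U := ∑ γ : G, ((γ : Uˣ) : U)
  let e : U := n⁻¹ • s
  have hγs : ∀ γ : G, ((γ : Uˣ) : U) * s = s := by
    intro γ
    simp only [s, Finset.mul_sum]
    exact Fintype.sum_equiv (Equiv.mulLeft γ) _ _ (fun δ => by simp)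
  have hss : s * s = n • s := by
    conv_lhs => enter [1]; simp only [s]
    rw [Finset.sum_mul, Finset.sum_congr rfl (fun γ _ => hγs γ)]
    simp [n, Nat.cast_smul_eq_nsmul]
  have he : e * e = e := by
    simp only [e]
    rw [smul_mul_smul_comm, hss, smul_smul, mul_assoc, inv_mul_cancel₀ hn, mul_one]
  have hsc : ∀ u, s * u = u * s := by
    intro u
    simp only [s, Finset.sum_mul, Finset.mul_sum]
    exact Finset.sum_congr rfl fun γ _ => ((hGcentral γ).comm u).eq
  have hc : ∀ u, e * u = u * e := by
    intro u
    simp only [e]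
    rw [smul_mul_assoc, hsc, mul_smul_comm]
  have hze : ∀ α, z α * e = 0 := by
    intro α
    have hzs : z α * s = 0 := by
      refine Submodule.span_induction (p := fun w _ => w * s = 0) ?_ ?_ ?_ ?_ (hzspan α)
      · rintro w ⟨γ, rfl⟩; simp [sub_mul, hγs γ]
      · simp
      · intro a b _ _ ha hb; simp [add_mul, ha, hb]
      · intro c a _ ha; simp [ha]
    simp only [e]
    rw [mul_smul_comm, hzs, smul_zero]
  have hεe : ε e = 1 := by
    simp only [e, s, map_smul, map_sum, hGaug]
    simp [n]
  let εB : RingQuot (relB U x N e) →ₐ[k] k := RingQuot.liftAlgHom k ⟨ε, by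
    rintro a b (⟨α⟩ | _)
    · simp [map_pow, hεx α, zero_pow (by have := hN α; omega : N α ≠ 0)]
    · rw [hεe, map_one]⟩
  let _ : HasDerivedCategory (ModuleCat (uDlm k U x N z)) := HasDerivedCategory.standard _
  let _ : HasDerivedCategory (ModuleCat (uDlm k U x N (fun _ => 0))) :=
    HasDerivedCategory.standard _
  let _ : HasDerivedCategory (ModuleCat (RingQuot (relB U x N e))) :=
    HasDerivedCategory.standard _
  have : HasExt.{1} (ModuleCat (uDlm k U x N z)) := hasExt_of_hasDerivedCategory _
  have : HasExt.{1} (ModuleCat (uDlm k U x N (fun _ => 0))) := hasExt_of_hasDerivedCategory _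
  have : HasExt.{1} (ModuleCat (RingQuot (relB U x N e))) := hasExt_of_hasDerivedCategory _
  have H1 := half k U P x N z e he hc hze (RingQuot.liftAlgHom k ⟨ε, by
        rintro a b ⟨α⟩
        have hz : ε (z α) = 0 := by
          refine Submodule.span_induction ?_ ?_ ?_ ?_ (hzspan α)
          · rintro w ⟨γ, rfl⟩; simp [hGaug γ]
          · simp
          · intro a b _ _ ha hb; simp [ha, hb]
          · intro c a _ ha; simp [ha]
        simp [map_pow, hεx α, zero_pow (by have := hN α; omega : N α ≠ 0), hz]⟩) εB
        (fun u => by simp only [εB, RingQuot.liftAlgHom_mkAlgHom_apply])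
  have H2 := half k U P x N (fun _ => 0) e he hc (fun _ => zero_mul _)
    (RingQuot.liftAlgHom k ⟨ε, by
        rintro a b ⟨α⟩
        simp [map_pow, hεx α, zero_pow (by have := hN α; omega : N α ≠ 0)]⟩) εB
        (fun u => by simp only [εB, RingQuot.liftAlgHom_mkAlgHom_apply])
  obtain ⟨E, E1, E2, E3⟩ := H1.symm.trans H2
  refine ⟨E, E1, fun a b u v => E2 a b _ rfl u v, fun m c u => ?_⟩
  exact (E2 0 m m (zero_add m) _ u).trans (by rw [E3])
end
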